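/- For every n ≥ 2, gcd(g_{n+1}, 2^n w_n + 2 y_n) = gcd(2^n w_n + 2 y_n, 2^n x_n² + 2 x_n z_n + 2). -/

import Mathlib

namespace Paper

/-- `s i = 2^{ν₂(i+1)}`, the largest power of 2 dividing `i+1`. -/
def s (i : ℕ) : ℕ := 2 ^ padicValNat 2 (i + 1)

/-- Continuant numerators, shifted by 2: `p 0 = p_{-2} = 0`, `p 1 = p_{-1} = 1`,
and `p (n+2) = p_n = s_n p_{n-1} + p_{n-2}`. -/
def p : ℕ → ℤ
  | 0 => 0
  | 1 => 1
  | n + 2 => (s n : ℤ) * p (n + 1) + p n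

/-- Continuant denominators, shifted by 2: `q 0 = q_{-2} = 1`, `q 1 = q_{-1} = 0`,
and `q (n+2) = q_n = s_n q_{n-1} + q_{n-2}`. -/
def q : ℕ → ℤ
  | 0 => 1
  | 1 => 0
  | n + 2 => (s n : ℤ) * q (n + 1) + q n

/-- Hurwitz–Kolden–Frame matrix of a finite sequence. -/
def M (l : List ℤ) : Matrix (Fin 2) (Fin 2) ℤ :=
  (l.map fun a => !![a, 1; 1, 0]).prod

/-- `u n = (s_1, s_2, ..., s_{2^n - 3})`. -/
def u (n : ℕ) : List ℤ := (List.range (2 ^ n - 3)).map fun i => (s (i + 1) : ℤ)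

/-- `v n = (s_1, s_2, ..., s_{2^n - 2})`. -/
def v (n : ℕ) : List ℤ := (List.range (2 ^ n - 2)).map fun i => (s (i + 1) : ℤ)

def c (n : ℕ) : ℤ := M (u n) 0 0
def e (n : ℕ) : ℤ := M (u n) 0 1
def d (n : ℕ) : ℤ := M (u n) 1 0
def f (n : ℕ) : ℤ := M (u n) 1 1
def w (n : ℕ) : ℤ := M (v n) 0 0
def y (n : ℕ) : ℤ := M (v n) 0 1
def x (n : ℕ) : ℤ := M (v n) 1 0
def z (n : ℕ) : ℤ := M (v n) 1 1
def g (n : ℕ) : ℤ := c n + 2 * e n + f n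
def r (n : ℕ) : ℤ := 2 ^ n * (w n + x n) + w n + y n + z n

end Paper

open Paper Filter Real

namespace Paper

theorem padicValNat_two_le_of_add_eq_two_pow {a b m : ℕ} (ha : 0 < a) (hb : 0 < b)
    (h : a + b = 2 ^ m) : padicValNat 2 a ≤ padicValNat 2 b := by
  have hdvd : 2 ^ padicValNat 2 a ∣ a := pow_padicValNat_dvd
  have hlt : padicValNat 2 a < m :=
    (Nat.pow_lt_pow_iff_right Nat.one_lt_two).1 (by have := Nat.le_of_dvd ha hdvd; omega)
  refine (padicValNat_dvd_iff_le hb.ne').1 ((Nat.dvd_add_right hdvd).1 ?_)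
  rw [h]
  exact pow_dvd_pow 2 hlt.le

theorem s_eq_of_add_eq {i j m : ℕ} (h : (i + 1) + (j + 1) = 2 ^ m) : s i = s j := by
  unfold s
  rw [le_antisymm (padicValNat_two_le_of_add_eq_two_pow i.succ_pos j.succ_pos h)
    (padicValNat_two_le_of_add_eq_two_pow j.succ_pos i.succ_pos ((add_comm _ _).trans h))]

theorem s_two_pow_sub_one (n : ℕ) : s (2 ^ n - 1) = 2 ^ n := by
  unfold s
  rw [Nat.sub_add_cancel Nat.one_le_two_pow, padicValNat.prime_pow]

theorem M_append (l l' : List ℤ) : M (l ++ l') = M l * M l' := by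
  simp [M]

theorem M_singleton (a : ℤ) : M [a] = !![a, 1; 1, 0] := by
  simp [M]

theorem M_reverse (l : List ℤ) : M l.reverse = (M l).transpose := by
  induction l with
  | nil => simp [M]
  | cons a l ih =>
    rw [List.reverse_cons, M_append, ih, ← List.singleton_append (l := l), M_append,
      Matrix.transpose_mul, M_singleton]
    congr 1
    ext i j
    fin_cases i <;> fin_cases j <;> rfl

theorem det_M (l : List ℤ) : (M l).det = (-1) ^ l.length := by
  induction l with
  | nil => simp [M]
  | cons a l ih =>
    rw [← List.singleton_append, M_append, Matrix.det_mul, ih, M_singleton, Matrix.det_fin_two_of]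
    simp [pow_succ]

theorem u_succ {n : ℕ} (hn : 1 ≤ n) :
    u (n + 1) = v n ++ [(2 : ℤ) ^ n] ++ (v n).reverse := by
  have h2 : 2 ≤ 2 ^ n := Nat.le_self_pow (by omega) 2
  have hsucc : 2 ^ (n + 1) = 2 * 2 ^ n := by ring
  refine List.ext_getElem ?_ fun i h₁ _ => ?_
  · simp [u, v]
    omega
  · have hi : i < 2 ^ (n + 1) - 3 := by simpa [u] using h₁
    rcases lt_trichotomy i (2 ^ n - 2) with h | h | h
    · simp [u, v, h]
    · have hs : s (i + 1) = 2 ^ n := by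
        rw [← s_two_pow_sub_one n]
        congr 1
        omega
      simp [u, v, ← h, hs]
    · have hlt : ¬ i < 2 ^ n - 2 + 1 := by omega
      simp only [u, v, List.getElem_append, List.length_append, List.length_map,
        List.length_range, List.length_singleton, hlt, dite_false, List.getElem_reverse,
        List.getElem_map, List.getElem_range]
      exact congrArg _ (s_eq_of_add_eq (m := n + 1) (by omega))

theorem w_mul_z_sub_y_mul_x {n : ℕ} (hn : 1 ≤ n) : w n * z n - y n * x n = 1 := by
  have heven : Even (v n).length := by
    have : Even (2 ^ n) := Nat.even_pow.2 ⟨even_two, by omega⟩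
    simpa [v] using this.tsub even_two
  have h := det_M (v n)
  rw [heven.neg_one_pow, Matrix.det_fin_two] at h
  exact h

theorem M_u_succ {n : ℕ} (hn : 1 ≤ n) :
    M (u (n + 1)) = M (v n) * !![(2 : ℤ) ^ n, 1; 1, 0] * (M (v n)).transpose := by
  rw [u_succ hn, M_append, M_append, M_singleton, M_reverse]

theorem g_succ {n : ℕ} (hn : 1 ≤ n) :
    g (n + 1) = (2 ^ n * x n ^ 2 + 2 * x n * z n + 2) +
      (w n + 2 * x n) * (2 ^ n * w n + 2 * y n) := by
  have hdet := w_mul_z_sub_y_mul_x hn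
  simp only [g, c, e, f, M_u_succ hn]
  unfold w x y z at *
  simp [Matrix.mul_apply, Fin.sum_univ_two]
  linear_combination 2 * hdet

end Paper

/-- For n ≥ 2, `gcd(g_{n+1}, 2^n w_n + 2 y_n) = gcd(2^n w_n + 2 y_n, 2^n x_n² + 2 x_n z_n + 2)`. -/
theorem gcd_g_succ (n : ℕ) (hn : 2 ≤ n) :
    Int.gcd (g (n + 1)) (2 ^ n * w n + 2 * y n) =
      Int.gcd (2 ^ n * w n + 2 * y n) (2 ^ n * x n ^ 2 + 2 * x n * z n + 2) := by
  rw [g_succ (by omega), Int.gcd_add_mul_right_left, Int.gcd_comm]
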